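/- Let W be the Weyl group of the root system of type G₂. Then (a) an element w ∈ W is fully commutative if and only if its length satisfies ℓ(w) ≤ 5, and (b) w satisfies ⟨α,β⟩ ≥ 0 for all α, β in its inversion set Φ(w) if and only if ℓ(w) ≤ 4. In particular, in type G₂ full commutativity is not equivalent to nonnegativity of the pairings on the inversion set. -/

import Mathlib

/- Background setup: a finite reduced crystallographic root system `Φ` with chosen
positive roots `Φ⁺` in a euclidean space `V`, the Cartan pairing, and the basic
combinatorial notions used in the statement. -/

open scoped RealInnerProductSpace

noncomputable section

variable {V : Type*} [NormedAddCommGroup V] [InnerProductSpace ℝ V]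

/-- The Cartan pairing `⟨α, β⟩ = 2 (α, β) / (β, β)`. -/
def cpair (α β : V) : ℝ := 2 * ⟪α, β⟫ / ⟪β, β⟫

/-- The reflection associated to `β`, as a linear endomorphism of `V`:
`v ↦ v - (2 (β, v)/(β, β)) • β`. -/
def reflEnd (β : V) : Module.End ℝ V :=
  LinearMap.id -
    (LinearMap.toSpanSingleton ℝ V β ∘ₗ ((2 / ⟪β, β⟫) • (innerSL ℝ β).toLinearMap))

/-- A subset of `V` is orthogonal if the Cartan pairing of any two distinct
elements vanishes. -/
def OrthogonalSet (S : Set V) : Prop := ∀ γ ∈ S, ∀ γ' ∈ S, γ ≠ γ' → cpair γ γ' = 0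

/-- A finite reduced crystallographic root system in the euclidean space `V`,
together with a choice of positive roots. -/
structure RootSystemData (V : Type*) [NormedAddCommGroup V] [InnerProductSpace ℝ V] where
  /-- the set of roots Φ -/
  roots : Set V
  /-- the set of positive roots Φ⁺ -/
  pos : Set V
  finite : roots.Finite
  ne_zero : ∀ α ∈ roots, α ≠ 0
  span_eq_top : Submodule.span ℝ roots = ⊤
  reduced : ∀ α ∈ roots, ∀ t : ℝ, t • α ∈ roots → t = 1 ∨ t = -1
  crystallographic : ∀ α ∈ roots, ∀ β ∈ roots, ∃ n : ℤ, cpair α β = (n : ℝ)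
  reflect_mem : ∀ α ∈ roots, ∀ β ∈ roots, reflEnd β α ∈ roots
  pos_subset : pos ⊆ roots
  pos_iff : ∀ α ∈ roots, (α ∈ pos ↔ ¬ (-α ∈ pos))
  pos_add : ∀ α ∈ pos, ∀ β ∈ pos, α + β ∈ roots → α + β ∈ pos

namespace RootSystemData

variable (D : RootSystemData V)

/-- Irreducibility: the roots admit no nontrivial partition into two mutually
orthogonal parts. -/
def IsIrreducible : Prop :=
  D.roots.Nonempty ∧
    ∀ s ⊆ D.roots, (∀ α ∈ s, ∀ β ∈ D.roots \ s, ⟪α, β⟫ = 0) → s = ∅ ∨ s = D.roots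

/-- An irreducible root system is not of type `G₂` iff no Cartan pairing of two
roots equals `±3`. -/
def NotG2 : Prop := ∀ α ∈ D.roots, ∀ β ∈ D.roots, cpair α β ≠ 3 ∧ cpair α β ≠ -3

/-- An irreducible root system is of type `G₂` iff some Cartan pairing of two
roots equals `±3`. -/
def IsG2 : Prop :=
  D.IsIrreducible ∧ ∃ α ∈ D.roots, ∃ β ∈ D.roots, cpair α β = 3 ∨ cpair α β = -3

/-- All roots have the same length (types A, D, E). -/
def SimplyLaced : Prop := ∀ α ∈ D.roots, ∀ β ∈ D.roots, ⟪α, α⟫ = ⟪β, β⟫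

/-- There are exactly two root lengths, with squared-length ratio 2
(types B, C, F₄). -/
def DoublyLaced : Prop :=
  (∃ α ∈ D.roots, ∃ β ∈ D.roots, ⟪β, β⟫ = 2 * ⟪α, α⟫) ∧
    ∀ α ∈ D.roots, ∀ β ∈ D.roots,
      ⟪α, α⟫ = ⟪β, β⟫ ∨ ⟪β, β⟫ = 2 * ⟪α, α⟫ ∨ ⟪α, α⟫ = 2 * ⟪β, β⟫

/-- A root of maximal length. -/
def IsLong (α : V) : Prop := α ∈ D.roots ∧ ∀ β ∈ D.roots, ⟪β, β⟫ ≤ ⟪α, α⟫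

/-- A root of minimal length. -/
def IsShort (α : V) : Prop := α ∈ D.roots ∧ ∀ β ∈ D.roots, ⟪α, α⟫ ≤ ⟪β, β⟫

/-- A set of positive roots is convex if any root which is a linear combination of
two of its elements with positive coefficients lies in it. -/
def ConvexSubset (S : Set V) : Prop :=
  ∀ α ∈ S, ∀ β ∈ S, ∀ a b : ℝ, 0 < a → 0 < b →
    a • α + b • β ∈ D.roots → a • α + b • β ∈ S

/-- A subset `Ψ ⊆ Φ⁺` is biconvex if both `Ψ` and `Φ⁺ \ Ψ` are convex. -/
def Biconvex (S : Set V) : Prop :=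
  S ⊆ D.pos ∧ D.ConvexSubset S ∧ D.ConvexSubset (D.pos \ S)

/-- A subset `Ψ ⊆ Φ⁺` is a combinatorial ideal if `α ∈ Ψ`, `β ∈ Φ⁺`, `α + β ∈ Φ⁺`
imply `α + β ∈ Ψ`. -/
def CombIdeal (S : Set V) : Prop :=
  S ⊆ D.pos ∧ ∀ α ∈ S, ∀ β ∈ D.pos, α + β ∈ D.pos → α + β ∈ S

end RootSystemData

/- The Weyl group: words in the simple reflections, reduced expressions, length,
inversion sets, and the (fully) commutative elements. -/

/-- The product of the reflections attached to a word (a list of roots). -/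
def wordProd (l : List V) : Module.End ℝ V := (l.map reflEnd).prod

/-- The alternating word `[α, β, α, β, ...]` of length `n`. -/
def altWord (α β : V) : ℕ → List V
  | 0 => []
  | n + 1 => α :: altWord β α n

namespace RootSystemData

variable (D : RootSystemData V)

/-- The simple roots: the positive roots which are not sums of two positive
roots. -/
def simpleRoots : Set V :=
  {α | α ∈ D.pos ∧ ¬ ∃ β ∈ D.pos, ∃ γ ∈ D.pos, α = β + γ}

/-- A word in the simple reflections, encoded as a list of simple roots. -/
def IsWord (l : List V) : Prop := ∀ α ∈ l, α ∈ D.simpleRoots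

/-- Membership in the Weyl group: `w` is a product of simple reflections. -/
def InWeyl (w : Module.End ℝ V) : Prop := ∃ l : List V, D.IsWord l ∧ wordProd l = w

/-- A reduced word: a word of minimal length among all words with the same
product. -/
def IsReducedWord (l : List V) : Prop :=
  D.IsWord l ∧
    ∀ l' : List V, D.IsWord l' → wordProd l' = wordProd l → l.length ≤ l'.length

/-- The length of a Weyl group element. -/
noncomputable def len (w : Module.End ℝ V) : ℕ :=
  sInf {n | ∃ l : List V, D.IsWord l ∧ wordProd l = w ∧ l.length = n}

/-- The inversion set `Φ(w) = {α ∈ Φ⁺ | w(α) ∈ Φ⁻}`. -/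
def inversions (w : Module.End ℝ V) : Set V :=
  {α | α ∈ D.pos ∧ w α ∈ D.roots ∧ w α ∉ D.pos}

/-- `w` is fully commutative: no reduced expression for `w` contains a contiguous
substring `s_α s_β s_α s_β ⋯` of length `m(s_α, s_β)`, where `s_α, s_β` are
non-commuting simple reflections and `m(s_α, s_β)` is the order of `s_α s_β`. -/
def FullyCommutative (w : Module.End ℝ V) : Prop :=
  D.InWeyl w ∧
    ∀ l : List V, D.IsReducedWord l → wordProd l = w →
      ∀ α ∈ D.simpleRoots, ∀ β ∈ D.simpleRoots,
        ¬ Commute (reflEnd α) (reflEnd β) →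
          ¬ (altWord α β (orderOf (reflEnd α * reflEnd β)) <:+: l)

/-- `w` is commutative: no reduced expression for `w` contains a substring
`s_α s_β s_α` with `α, β` simple and `‖α‖ ≤ ‖β‖`. -/
def Commutative (w : Module.End ℝ V) : Prop :=
  D.InWeyl w ∧
    ∀ l : List V, D.IsReducedWord l → wordProd l = w →
      ∀ α ∈ D.simpleRoots, ∀ β ∈ D.simpleRoots, ‖α‖ ≤ ‖β‖ →
        ¬ ([α, β, α] <:+: l)

end RootSystemData

/-! ### General facts -/

theorem reflEnd_apply' (β v : V) : reflEnd β v = v - (2 / ⟪β, β⟫ * ⟪β, v⟫) • β := by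
  simp [reflEnd]

theorem refl_of_cpair {β v : V} (hβ : β ≠ 0) {c : ℝ} (h : 2 * ⟪β, v⟫ = c * ⟪β, β⟫) :
    reflEnd β v = v - c • β := by
  have h0 : ⟪β, β⟫ ≠ 0 := inner_self_ne_zero.mpr hβ
  rw [reflEnd_apply']
  congr 2
  field_simp
  linarith

theorem RootSystemData.neg_mem (D : RootSystemData V) {α : V} (h : α ∈ D.roots) :
    -α ∈ D.roots := by
  have := D.reflect_mem α h α h
  rw [refl_of_cpair (D.ne_zero α h) (c := 2) rfl] at this
  convert this using 1
  module

/-- The pair of Cartan integers of two non proportional roots. -/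
theorem RootSystemData.cartan_pair (D : RootSystemData V) {γ δ : V} (hγ : γ ∈ D.roots)
    (hδ : δ ∈ D.roots) (h1 : γ ≠ δ) (h2 : γ ≠ -δ) :
    ∃ n m : ℤ, (n : ℝ) * ⟪δ, δ⟫ = 2 * ⟪γ, δ⟫ ∧ (m : ℝ) * ⟪γ, γ⟫ = 2 * ⟪γ, δ⟫ ∧
      n * m < 4 ∧ 0 ≤ n * m ∧ (n = 0 ↔ m = 0) := by
  obtain ⟨n, hn⟩ := D.crystallographic γ hγ δ hδ
  obtain ⟨m, hm⟩ := D.crystallographic δ hδ γ hγ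
  have hd : 0 < ⟪δ, δ⟫ := real_inner_self_pos.mpr (D.ne_zero δ hδ)
  have hg : 0 < ⟪γ, γ⟫ := real_inner_self_pos.mpr (D.ne_zero γ hγ)
  have en : (n : ℝ) * ⟪δ, δ⟫ = 2 * ⟪γ, δ⟫ := by
    rw [← hn, cpair]; field_simp
  have em : (m : ℝ) * ⟪γ, γ⟫ = 2 * ⟪γ, δ⟫ := by
    rw [← hm, cpair, real_inner_comm γ δ]; field_simp
  have key : ((n * m : ℤ) : ℝ) * (⟪δ, δ⟫ * ⟪γ, γ⟫) = 4 * (⟪γ, δ⟫ * ⟪γ, δ⟫) := by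
    push_cast
    calc _ = ((n : ℝ) * ⟪δ, δ⟫) * ((m : ℝ) * ⟪γ, γ⟫) := by ring
      _ = _ := by rw [en, em]; ring
  have hp : 0 < ⟪δ, δ⟫ * ⟪γ, γ⟫ := mul_pos hd hg
  refine ⟨n, m, en, em, ?_, ?_, ?_⟩
  · by_contra hcon
    have hcon' : (4 : ℝ) ≤ ((n * m : ℤ) : ℝ) := by exact_mod_cast not_lt.mp hcon
    -- the vector `δ`-component of `γ` is all of `γ`
    have hv : ⟪γ - ((n : ℝ) / 2) • δ, γ - ((n : ℝ) / 2) • δ⟫ ≤ 0 := by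
      have e : ⟪γ - ((n : ℝ) / 2) • δ, γ - ((n : ℝ) / 2) • δ⟫ * ⟪δ, δ⟫ =
          ⟪γ, γ⟫ * ⟪δ, δ⟫ - ⟪γ, δ⟫ * ⟪γ, δ⟫ := by
        simp only [inner_sub_left, inner_sub_right, real_inner_smul_left, real_inner_smul_right,
          real_inner_comm γ δ]
        have e2 : ⟪γ, δ⟫ = (n : ℝ) * ⟪δ, δ⟫ / 2 := by linarith
        rw [e2]; ring
      by_contra hc
      have := mul_pos (not_le.mp hc) hd
      nlinarith
    have hz : γ - ((n : ℝ) / 2) • δ = 0 := real_inner_self_nonpos.mp hv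
    have hz' : γ = ((n : ℝ) / 2) • δ := sub_eq_zero.mp hz
    rcases D.reduced δ hδ ((n : ℝ) / 2) (hz' ▸ hγ) with h | h
    · rw [h, one_smul] at hz'; exact h1 hz'
    · rw [h, neg_one_smul] at hz'; exact h2 hz'
  · have : (0 : ℝ) ≤ ((n * m : ℤ) : ℝ) := by
      by_contra hc
      have := mul_neg_of_neg_of_pos (not_le.mp hc) hp
      nlinarith [mul_self_nonneg ⟪γ, δ⟫]
    exact_mod_cast this
  · constructor
    · rintro rfl
      have : (m : ℝ) * ⟪γ, γ⟫ = 0 := by rw [em, ← en]; simp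
      have := (mul_eq_zero.mp this).resolve_right hg.ne'
      exact_mod_cast this
    · rintro rfl
      have : (n : ℝ) * ⟪δ, δ⟫ = 0 := by rw [en, ← em]; simp
      have := (mul_eq_zero.mp this).resolve_right hd.ne'
      exact_mod_cast this

/-! ### Integer model of `G₂` -/

/-- coordinates of the positive roots in the base (short, long) -/
def posL : List (ℤ × ℤ) := [(1, 0), (0, 1), (1, 1), (2, 1), (3, 1), (3, 2)]

/-- coordinates of all roots -/
def rootL : List (ℤ × ℤ) := posL ++ posL.map fun p => -p

/-- bilinear form (twice the inner product, in units of the short squared length) -/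
def bf (p r : ℤ × ℤ) : ℤ := 2 * p.1 * r.1 - 3 * (p.1 * r.2 + p.2 * r.1) + 6 * p.2 * r.2

/-- action of a matrix given by the images of the base -/
def act (M : (ℤ × ℤ) × (ℤ × ℤ)) (p : ℤ × ℤ) : ℤ × ℤ :=
  (p.1 * M.1.1 + p.2 * M.2.1, p.1 * M.1.2 + p.2 * M.2.2)

/-- the simple reflections -/
def gen : Bool → (ℤ × ℤ) × (ℤ × ℤ)
  | false => ((-1, 0), (3, 1))
  | true => ((1, 1), (0, -1))

/-- left multiplication by a simple reflection -/
def step (i : Bool) (M : (ℤ × ℤ) × (ℤ × ℤ)) : (ℤ × ℤ) × (ℤ × ℤ) :=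
  (act (gen i) M.1, act (gen i) M.2)

/-- the matrix of a word -/
def evalW (l : List Bool) : (ℤ × ℤ) × (ℤ × ℤ) := l.foldr step ((1, 0), (0, 1))

/-- number of inversions -/
def invN (M : (ℤ × ℤ) × (ℤ × ℤ)) : ℕ := (posL.filter fun p => act M p ∉ posL).length

/-- reduced words for all elements -/
def redWords : List (List Bool) :=
  [[], [false], [true], [false, true], [true, false], [false, true, false], [true, false, true],
   [false, true, false, true], [true, false, true, false], [false, true, false, true, false],
   [true, false, true, false, true], [false, true, false, true, false, true]]

theorem step_mem : ∀ i : Bool, ∀ u ∈ redWords, ∃ v ∈ redWords, evalW v = step i (evalW u) ∧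
    v.length ≤ u.length + 1 := by decide +kernel

theorem redWords_len : ∀ u ∈ redWords, u.length = invN (evalW u) := by decide +kernel

theorem redWords_root : ∀ u ∈ redWords, ∀ p ∈ posL, act (evalW u) p ∈ rootL := by decide +kernel

theorem redWords_pair : ∀ u ∈ redWords,
    ((∀ p ∈ posL, ∀ r ∈ posL, act (evalW u) p ∉ posL → act (evalW u) r ∉ posL → 0 ≤ bf p r) ↔
      u.length ≤ 4) := by decide +kernel

theorem redWords_six : ∀ u ∈ redWords, u.length ≤ 5 ∨
    u = [false, true, false, true, false, true] := by decide +kernel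

theorem exists_red (l : List Bool) : ∃ v ∈ redWords, evalW v = evalW l ∧ v.length ≤ l.length := by
  induction l with
  | nil => exact ⟨[], by decide, rfl, le_rfl⟩
  | cons i l ih =>
    obtain ⟨u, hu, he, hl⟩ := ih
    obtain ⟨v, hv, he', hl'⟩ := step_mem i u hu
    refine ⟨v, hv, ?_, ?_⟩
    · rw [he', he]; rfl
    · simp only [List.length_cons]; omega

theorem red_min {u : List Bool} (hu : u ∈ redWords) {l : List Bool} (h : evalW l = evalW u) :
    u.length ≤ l.length := by
  obtain ⟨v, hv, he, hl⟩ := exists_red l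
  rw [redWords_len u hu, ← h, ← he, ← redWords_len v hv]
  exact hl

theorem int_check : ∀ n1 ∈ Finset.Icc (-3 : ℤ) 3, ∀ m1 ∈ Finset.Icc (-3 : ℤ) 3,
    0 ≤ n1 * m1 → n1 * m1 < 4 → (n1 = 0 ↔ m1 = 0) →
    ∀ n2 ∈ Finset.Icc (-3 : ℤ) 3, ∀ m2 ∈ Finset.Icc (-3 : ℤ) 3,
    (n2 = 0 ↔ m2 = 0) → 0 ≤ n2 * m2 →
    n1 * m2 = 3 * (n2 * m1) → n2 * m2 < 4 → (n1 + 3 * n2) * (m1 + m2) < 4 →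
    (2 * n1 + 3 * n2) * (2 * m1 + m2) < 4 → (n1 + n2) * (3 * m1 + m2) < 4 →
    (n1 + 2 * n2) * (3 * m1 + 2 * m2) < 4 → n1 = 0 ∧ n2 = 0 := by decide +kernel

theorem int_bound {n m : ℤ} (h0 : 0 ≤ n * m) (h4 : n * m < 4) (h : n = 0 ↔ m = 0) :
    n ∈ Finset.Icc (-3 : ℤ) 3 ∧ m ∈ Finset.Icc (-3 : ℤ) 3 := by
  simp only [Finset.mem_Icc]
  by_cases hn : n = 0
  · have := h.mp hn; subst hn; subst this; simp
  · have hm : m ≠ 0 := fun e => hn (h.mpr e)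
    rcases lt_or_gt_of_ne hn with a | a <;> rcases lt_or_gt_of_ne hm with b | b <;>
      refine ⟨⟨?_, ?_⟩, ?_, ?_⟩ <;> nlinarith

/-! ### The geometric `G₂` pair -/

/-- the vector with given coordinates -/
def vec (a b : V) (p : ℤ × ℤ) : V := (p.1 : ℝ) • a + (p.2 : ℝ) • b

/-- a base of type `G₂`, `a` short and `b` long -/
structure GP (D : RootSystemData V) (a b : V) : Prop where
  ma : a ∈ D.roots
  mb : b ∈ D.roots
  hb : ⟪b, b⟫ = 3 * ⟪a, a⟫
  hab : 2 * ⟪a, b⟫ = -3 * ⟪a, a⟫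

namespace GP

variable {D : RootSystemData V} {a b : V}

theorem apos (h : GP D a b) : 0 < ⟪a, a⟫ := real_inner_self_pos.mpr (D.ne_zero a h.ma)

theorem inner_vec (h : GP D a b) (p r : ℤ × ℤ) :
    2 * ⟪vec a b p, vec a b r⟫ = (bf p r : ℝ) * ⟪a, a⟫ := by
  simp only [vec, inner_add_left, inner_add_right, real_inner_smul_left, real_inner_smul_right,
    real_inner_comm a b, bf]
  rw [h.hb, show ⟪a, b⟫ = -3 * ⟪a, a⟫ / 2 by linarith [h.hab]]
  push_cast
  ring

theorem vec_inj (h : GP D a b) {p r : ℤ × ℤ} (e : vec a b p = vec a b r) : p = r := by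
  have h0 : vec a b (p - r) = 0 := by
    have : vec a b (p - r) = vec a b p - vec a b r := by
      simp only [vec, Prod.fst_sub, Prod.snd_sub]; push_cast; module
    rw [this, e, sub_self]
  have h1 := h.inner_vec (p - r) (p - r)
  rw [h0, inner_zero_left, mul_zero] at h1
  have h2 := (mul_eq_zero.mp h1.symm).resolve_right h.apos.ne'
  have h3 : bf (p - r) (p - r) = 0 := by exact_mod_cast h2
  simp only [bf, Prod.fst_sub, Prod.snd_sub] at h3
  have h4 : (2 * (p.1 - r.1) - 3 * (p.2 - r.2)) ^ 2 + 3 * (p.2 - r.2) ^ 2 = 0 := by linarith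
  have h5 : p.2 - r.2 = 0 := by
    have : (p.2 - r.2) ^ 2 = 0 := by
      nlinarith [sq_nonneg (2 * (p.1 - r.1) - 3 * (p.2 - r.2)), sq_nonneg (p.2 - r.2)]
    exact (pow_eq_zero_iff two_ne_zero).mp this
  rw [h5] at h4
  have h6 : p.1 - r.1 = 0 := by
    have : (p.1 - r.1) ^ 2 = 0 := by linarith
    exact (pow_eq_zero_iff two_ne_zero).mp this
  ext <;> omega

theorem refl_a (h : GP D a b) (p : ℤ × ℤ) :
    reflEnd a (vec a b p) = vec a b (act (gen false) p) := by
  rw [refl_of_cpair (D.ne_zero a h.ma) (c := 2 * p.1 - 3 * p.2)]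
  · simp only [vec, act, gen]; push_cast; module
  · simp only [vec, inner_add_right, real_inner_smul_right]
    linear_combination (p.2 : ℝ) * h.hab

theorem refl_b (h : GP D a b) (p : ℤ × ℤ) :
    reflEnd b (vec a b p) = vec a b (act (gen true) p) := by
  rw [refl_of_cpair (D.ne_zero b h.mb) (c := 2 * p.2 - p.1)]
  · simp only [vec, act, gen]; push_cast; module
  · simp only [vec, inner_add_right, real_inner_smul_right, real_inner_comm a b]
    linear_combination (p.1 : ℝ) * h.hab + (p.1 : ℝ) * h.hb

theorem vec_mem (h : GP D a b) {p : ℤ × ℤ} (hp : p ∈ rootL) : vec a b p ∈ D.roots := by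
  have h1 : vec a b (1, 0) ∈ D.roots := by simpa [vec] using h.ma
  have h2 : vec a b (0, 1) ∈ D.roots := by simpa [vec] using h.mb
  have A : ∀ p, vec a b p ∈ D.roots → vec a b (act (gen false) p) ∈ D.roots := fun p hp =>
    h.refl_a p ▸ D.reflect_mem _ hp _ h.ma
  have B : ∀ p, vec a b p ∈ D.roots → vec a b (act (gen true) p) ∈ D.roots := fun p hp =>
    h.refl_b p ▸ D.reflect_mem _ hp _ h.mb
  have h3 : vec a b (1, 1) ∈ D.roots := B _ h1
  have h4 : vec a b (3, 1) ∈ D.roots := A _ h2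
  have h5 : vec a b (2, 1) ∈ D.roots := A _ h3
  have h6 : vec a b (3, 2) ∈ D.roots := B _ h4
  have hpos : ∀ p ∈ posL, vec a b p ∈ D.roots := by
    simp only [posL, List.forall_mem_cons]
    exact ⟨h1, h2, h3, h5, h4, h6, by simp⟩
  have hneg : ∀ p, vec a b (-p) = -vec a b p := fun p => by
    simp only [vec, Prod.fst_neg, Prod.snd_neg]; push_cast; module
  rcases List.mem_append.mp hp with hp | hp
  · exact hpos p hp
  · obtain ⟨r, hr, rfl⟩ := List.mem_map.mp hp
    rw [hneg]
    exact D.neg_mem (hpos r hr)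

theorem vec_neg (p : ℤ × ℤ) : vec a b (-p) = -vec a b p := by
  simp only [vec, Prod.fst_neg, Prod.snd_neg]; push_cast; module

theorem neg_rootL : ∀ p ∈ rootL, -p ∈ rootL := by decide

theorem orth (h : GP D a b) {γ : V} (hγ : γ ∈ D.roots) (hn : ∀ p ∈ rootL, γ ≠ vec a b p) :
    ⟪γ, a⟫ = 0 ∧ ⟪γ, b⟫ = 0 := by
  have C : ∀ p ∈ rootL, ∃ n m : ℤ, (n : ℝ) * ⟪vec a b p, vec a b p⟫ = 2 * ⟪γ, vec a b p⟫ ∧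
      (m : ℝ) * ⟪γ, γ⟫ = 2 * ⟪γ, vec a b p⟫ ∧ n * m < 4 ∧ 0 ≤ n * m ∧ (n = 0 ↔ m = 0) :=
    fun p hp => D.cartan_pair hγ (h.vec_mem hp) (hn p hp)
      (by rw [← vec_neg]; exact hn _ (neg_rootL p hp))
  have S : ∀ p, 2 * ⟪γ, vec a b p⟫ = p.1 * (2 * ⟪γ, a⟫) + p.2 * (2 * ⟪γ, b⟫) := fun p => by
    simp only [vec, inner_add_right, real_inner_smul_right]; ring
  have Q : ∀ p, ⟪vec a b p, vec a b p⟫ = (bf p p : ℝ) * ⟪a, a⟫ / 2 := fun p => by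
    rw [← h.inner_vec]; ring
  have q := h.apos
  have N : 0 < ⟪γ, γ⟫ := real_inner_self_pos.mpr (D.ne_zero γ hγ)
  obtain ⟨n1, m1, e1, f1, u1, v1, w1⟩ := C (1, 0) (by decide)
  obtain ⟨n2, m2, e2, f2, u2, v2, w2⟩ := C (0, 1) (by decide)
  obtain ⟨n3, m3, e3, f3, u3, -⟩ := C (1, 1) (by decide)
  obtain ⟨n4, m4, e4, f4, u4, -⟩ := C (2, 1) (by decide)
  obtain ⟨n5, m5, e5, f5, u5, -⟩ := C (3, 1) (by decide)
  obtain ⟨n6, m6, e6, f6, u6, -⟩ := C (3, 2) (by decide)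
  rw [Q, S] at e1 e2 e3 e4 e5 e6
  rw [S] at f1 f2 f3 f4 f5 f6
  norm_num [bf] at e1 e2 e3 e4 e5 e6 f1 f2 f3 f4 f5 f6
  simp only [← real_inner_self_eq_norm_sq] at e1 e2 e3 e4 e5 e6 f1 f2 f3 f4 f5 f6
  have E : ∀ x y : ℤ, (x : ℝ) * ⟪a, a⟫ = y * ⟪a, a⟫ → x = y := fun x y e => by
    exact_mod_cast mul_right_cancel₀ q.ne' e
  have F : ∀ x y : ℤ, (x : ℝ) * ⟪γ, γ⟫ = y * ⟪γ, γ⟫ → x = y := fun x y e => by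
    exact_mod_cast mul_right_cancel₀ N.ne' e
  have r3 : n3 = n1 + 3 * n2 := E _ _ (by push_cast; linarith)
  have r4 : n4 = 2 * n1 + 3 * n2 := E _ _ (by push_cast; linarith)
  have r5 : n5 = n1 + n2 := E _ _ (by push_cast; linarith)
  have r6 : n6 = n1 + 2 * n2 := E _ _ (by push_cast; linarith)
  have t3 : m3 = m1 + m2 := F _ _ (by push_cast; linarith)
  have t4 : m4 = 2 * m1 + m2 := F _ _ (by push_cast; linarith)
  have t5 : m5 = 3 * m1 + m2 := F _ _ (by push_cast; linarith)
  have t6 : m6 = 3 * m1 + 2 * m2 := F _ _ (by push_cast; linarith)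
  have cr : n1 * m2 = 3 * (n2 * m1) := by
    have : ((n1 * m2 : ℤ) : ℝ) * (⟪a, a⟫ * ⟪γ, γ⟫) =
        ((3 * (n2 * m1) : ℤ) : ℝ) * (⟪a, a⟫ * ⟪γ, γ⟫) := by
      push_cast
      linear_combination (m2 : ℝ) * ⟪γ, γ⟫ * e1 - (m1 : ℝ) * ⟪γ, γ⟫ * e2 +
        2 * ⟪γ, a⟫ * f2 - 2 * ⟪γ, b⟫ * f1
    exact_mod_cast mul_right_cancel₀ (mul_pos q N).ne' this
  subst r3 r4 r5 r6 t3 t4 t5 t6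
  obtain ⟨b1, b1'⟩ := int_bound v1 u1 w1
  obtain ⟨b2, b2'⟩ := int_bound v2 u2 w2
  obtain ⟨z1, z2⟩ := int_check n1 b1 m1 b1' v1 u1 w1 n2 b2 m2 b2' w2 v2 cr u2 u3 u4 u5 u6
  subst z1 z2
  simp only [Int.cast_zero, zero_mul] at e1 e2
  exact ⟨by linarith, by linarith⟩

theorem roots_eq (h : GP D a b) (hI : D.IsIrreducible) {γ : V} (hγ : γ ∈ D.roots) :
    ∃ p ∈ rootL, γ = vec a b p := by
  have := hI.2 {γ | ∃ p ∈ rootL, γ = vec a b p}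
    (by rintro _ ⟨p, hp, rfl⟩; exact h.vec_mem hp)
    (by
      rintro _ ⟨p, hp, rfl⟩ β ⟨hβ, hβ'⟩
      have := h.orth hβ (fun r hr e => hβ' ⟨r, hr, e⟩)
      rw [real_inner_comm]
      simp [vec, inner_add_right, real_inner_smul_right, this.1, this.2])
  rcases this with e | e
  · exact absurd (show a ∈ (∅ : Set V) from e ▸ ⟨(1, 0), by decide, by simp [vec]⟩) (by simp)
  · rw [← e] at hγ; exact hγ

end GP

/-- A `G₂` pair exists. -/
theorem exists_GP (D : RootSystemData V) (h : D.IsG2) : ∃ a b, GP D a b := by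
  obtain ⟨-, α, hα, β, hβ, h3⟩ := h
  have ha : 0 < ⟪α, α⟫ := real_inner_self_pos.mpr (D.ne_zero α hα)
  have hb : 0 < ⟪β, β⟫ := real_inner_self_pos.mpr (D.ne_zero β hβ)
  have aux : ∀ γ ∈ D.roots, cpair γ β = -3 → ∃ a b, GP D a b := by
    intro γ hγ hc
    have hb : 0 < ⟪β, β⟫ := real_inner_self_pos.mpr (D.ne_zero β hβ)
    have hg : 0 < ⟪γ, γ⟫ := real_inner_self_pos.mpr (D.ne_zero γ hγ)
    have e : 2 * ⟪γ, β⟫ = -3 * ⟪β, β⟫ := by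
      rw [cpair, div_eq_iff hb.ne'] at hc; exact hc
    obtain ⟨n, m, e1, e2, u, v, w⟩ := D.cartan_pair hγ hβ
      (by rintro rfl; linarith) (by rintro rfl; rw [inner_neg_left] at e; linarith)
    have hn : n = -3 := by
      have : (n : ℝ) = (-3 : ℤ) := mul_right_cancel₀ hb.ne' (by push_cast; linarith)
      exact_mod_cast this
    subst hn
    have hm : m = -1 := by omega
    subst hm
    push_cast at e2
    exact ⟨β, γ, hβ, hγ, by linarith, by rw [real_inner_comm]; exact e⟩
  rcases h3 with h3 | h3
  · exact aux (-α) (D.neg_mem hα) (by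
      rw [cpair, inner_neg_left, ← h3, cpair]; ring)
  · exact aux α hα h3

/-- A `G₂` pair of positive roots exists. -/
theorem exists_GP_pos (D : RootSystemData V) (h : D.IsG2) :
    ∃ a b, GP D a b ∧ a ∈ D.pos ∧ b ∈ D.pos := by
  obtain ⟨s, l, g⟩ := exists_GP D h
  by_contra hcon
  push Not at hcon
  have key : ∀ p ∈ rootL, ∀ r ∈ rootL, bf r r = 3 * bf p p → 2 * bf p r = -3 * bf p p →
      vec s l p ∈ D.pos → vec s l r ∉ D.pos := by
    intro p hp r hr h1 h2
    refine hcon _ _ ⟨g.vec_mem hp, g.vec_mem hr, ?_, ?_⟩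
    · have e1 := g.inner_vec p p
      have e2 := g.inner_vec r r
      rw [h1] at e2; push_cast at e2; linarith
    · have e1 := g.inner_vec p p
      have e2 := g.inner_vec p r
      have h2' : 2 * (bf p r : ℝ) = -3 * bf p p := by exact_mod_cast h2
      linear_combination e2 + (⟪s, s⟫ / 2) * h2' + (3 / 2) * e1
  have sg : ∀ p ∈ rootL, (vec s l p ∈ D.pos ↔ vec s l (-p) ∉ D.pos) := fun p hp => by
    rw [GP.vec_neg]; exact D.pos_iff _ (g.vec_mem hp)
  -- going round the circle, positivity propagates
  have st : ∀ p ∈ rootL, ∀ r ∈ rootL, bf r r = 3 * bf p p → 2 * bf p r = -3 * bf p p →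
      (vec s l p ∈ D.pos → vec s l (-r) ∈ D.pos) ∧ (vec s l r ∈ D.pos → vec s l (-p) ∈ D.pos) := by
    intro p hp r hr h1 h2
    have := key p hp r hr h1 h2
    have := sg p hp
    have := sg r hr
    tauto
  have c0 : vec s l (1, 0) ∈ D.pos → vec s l (3, 1) ∈ D.pos :=
    by simpa only [Prod.neg_mk, neg_neg, neg_zero] using (st (1, 0) (by decide) (-3, -1) (by decide) (by decide) (by decide)).1
  have c1 : vec s l (3, 1) ∈ D.pos → vec s l (2, 1) ∈ D.pos :=
    by simpa only [Prod.neg_mk, neg_neg, neg_zero] using (st (-2, -1) (by decide) (3, 1) (by decide) (by decide) (by decide)).2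
  have c2 : vec s l (2, 1) ∈ D.pos → vec s l (3, 2) ∈ D.pos :=
    by simpa only [Prod.neg_mk, neg_neg, neg_zero] using (st (2, 1) (by decide) (-3, -2) (by decide) (by decide) (by decide)).1
  have c3 : vec s l (3, 2) ∈ D.pos → vec s l (1, 1) ∈ D.pos :=
    by simpa only [Prod.neg_mk, neg_neg, neg_zero] using (st (-1, -1) (by decide) (3, 2) (by decide) (by decide) (by decide)).2
  have c4 : vec s l (1, 1) ∈ D.pos → vec s l (0, 1) ∈ D.pos :=
    by simpa only [Prod.neg_mk, neg_neg, neg_zero] using (st (1, 1) (by decide) (0, -1) (by decide) (by decide) (by decide)).1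
  have c5 : vec s l (0, 1) ∈ D.pos → vec s l (-1, 0) ∈ D.pos :=
    by simpa only [Prod.neg_mk, neg_neg, neg_zero] using (st (1, 0) (by decide) (0, 1) (by decide) (by decide) (by decide)).2
  have c6 : vec s l (-1, 0) ∈ D.pos → vec s l (-3, -1) ∈ D.pos :=
    by simpa only [Prod.neg_mk, neg_neg, neg_zero] using (st (-1, 0) (by decide) (3, 1) (by decide) (by decide) (by decide)).1
  have c7 : vec s l (-3, -1) ∈ D.pos → vec s l (-2, -1) ∈ D.pos :=
    by simpa only [Prod.neg_mk, neg_neg, neg_zero] using (st (2, 1) (by decide) (-3, -1) (by decide) (by decide) (by decide)).2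
  have c8 : vec s l (-2, -1) ∈ D.pos → vec s l (-3, -2) ∈ D.pos :=
    by simpa only [Prod.neg_mk, neg_neg, neg_zero] using (st (-2, -1) (by decide) (3, 2) (by decide) (by decide) (by decide)).1
  have c9 : vec s l (-3, -2) ∈ D.pos → vec s l (-1, -1) ∈ D.pos :=
    by simpa only [Prod.neg_mk, neg_neg, neg_zero] using (st (1, 1) (by decide) (-3, -2) (by decide) (by decide) (by decide)).2
  have c10 : vec s l (-1, -1) ∈ D.pos → vec s l (0, -1) ∈ D.pos :=
    by simpa only [Prod.neg_mk, neg_neg, neg_zero] using (st (-1, -1) (by decide) (0, 1) (by decide) (by decide) (by decide)).1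
  have c11 : vec s l (0, -1) ∈ D.pos → vec s l (1, 0) ∈ D.pos :=
    by simpa only [Prod.neg_mk, neg_neg, neg_zero] using (st (-1, 0) (by decide) (0, -1) (by decide) (by decide) (by decide)).2
  have n1 : vec s l (1, 0) ∈ D.pos ↔ vec s l (-1, 0) ∉ D.pos := sg (1, 0) (by decide)
  have up : vec s l (1, 0) ∈ D.pos → vec s l (-1, 0) ∈ D.pos :=
    fun z => c5 (c4 (c3 (c2 (c1 (c0 z)))))
  have dn : vec s l (-1, 0) ∈ D.pos → vec s l (1, 0) ∈ D.pos :=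
    fun z => c11 (c10 (c9 (c8 (c7 (c6 z)))))
  by_cases z : vec s l (1, 0) ∈ D.pos
  · exact n1.mp z (up z)
  · exact z (n1.mpr fun y => z (dn y))

/-! ### A positive `G₂` base -/

/-- a positive base with the full root system known -/
structure PB (D : RootSystemData V) (a b : V) : Prop extends GP D a b where
  roots_iff : ∀ γ, γ ∈ D.roots ↔ ∃ p ∈ rootL, γ = vec a b p
  pos_iff' : ∀ γ, γ ∈ D.pos ↔ ∃ p ∈ posL, γ = vec a b p
  simple_iff : ∀ γ, γ ∈ D.simpleRoots ↔ γ = a ∨ γ = b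

theorem vec_add (a b : V) (p r : ℤ × ℤ) : vec a b (p + r) = vec a b p + vec a b r := by
  simp only [vec, Prod.fst_add, Prod.snd_add]; push_cast; module

theorem posL_sum : ∀ p ∈ posL, ∀ r ∈ posL, p + r ≠ (1, 0) ∧ p + r ≠ (0, 1) := by decide

theorem rootL_cases : ∀ p ∈ rootL, p ∈ posL ∨ -p ∈ posL := by decide

theorem posL_rootL : ∀ p ∈ posL, p ∈ rootL := by decide

theorem exists_PB (D : RootSystemData V) (h : D.IsG2) : ∃ a b, PB D a b := by
  obtain ⟨a, b, g, pa, pb⟩ := exists_GP_pos D h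
  have p1 : vec a b (1, 0) ∈ D.pos := by simpa [vec] using pa
  have p2 : vec a b (0, 1) ∈ D.pos := by simpa [vec] using pb
  have add : ∀ p r, vec a b p ∈ D.pos → vec a b r ∈ D.pos → p + r ∈ rootL →
      vec a b (p + r) ∈ D.pos := fun p r hp hr h => by
    have := g.vec_mem h
    rw [vec_add] at this ⊢
    exact D.pos_add _ hp _ hr this
  have p3 : vec a b (1, 1) ∈ D.pos := add _ _ p1 p2 (by decide)
  have p4 : vec a b (2, 1) ∈ D.pos := add _ _ p1 p3 (by decide)
  have p5 : vec a b (3, 1) ∈ D.pos := add _ _ p1 p4 (by decide)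
  have p6 : vec a b (3, 2) ∈ D.pos := add _ _ p5 p2 (by decide)
  have P : ∀ p ∈ posL, vec a b p ∈ D.pos := by
    simp only [posL, List.forall_mem_cons]
    exact ⟨p1, p2, p3, p4, p5, p6, by simp⟩
  have hr : ∀ γ, γ ∈ D.roots ↔ ∃ p ∈ rootL, γ = vec a b p := fun γ =>
    ⟨g.roots_eq h.1, by rintro ⟨p, hp, rfl⟩; exact g.vec_mem hp⟩
  have hpos : ∀ γ, γ ∈ D.pos ↔ ∃ p ∈ posL, γ = vec a b p := by
    refine fun γ => ⟨fun hγ => ?_, by rintro ⟨p, hp, rfl⟩; exact P p hp⟩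
    obtain ⟨p, hp, rfl⟩ := (hr γ).mp (D.pos_subset hγ)
    rcases rootL_cases p hp with h' | h'
    · exact ⟨p, h', rfl⟩
    · have := (D.pos_iff _ (D.pos_subset hγ)).mp hγ
      rw [← GP.vec_neg] at this
      exact absurd (P _ h') this
  refine ⟨a, b, g, hr, hpos, fun γ => ⟨?_, ?_⟩⟩
  · rintro ⟨hγ, hs⟩
    obtain ⟨p, hp, rfl⟩ := (hpos γ).mp hγ
    have no : ∀ r t, vec a b r ∈ D.pos → vec a b t ∈ D.pos → p ≠ r + t := by
      rintro r t h1 h2 rfl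
      exact hs ⟨_, h1, _, h2, vec_add a b r t⟩
    simp only [posL, List.mem_cons, List.not_mem_nil, or_false] at hp
    rcases hp with rfl | rfl | rfl | rfl | rfl | rfl
    · left; simp [vec]
    · right; simp [vec]
    · exact absurd (by decide) (no _ _ p1 p2)
    · exact absurd (by decide) (no _ _ p1 p3)
    · exact absurd (by decide) (no _ _ p1 p4)
    · exact absurd (by decide) (no _ _ p5 p2)
  · have ea : a = vec a b (1, 0) := by simp [vec]
    have eb : b = vec a b (0, 1) := by simp [vec]
    rintro (rfl | rfl)
    · refine ⟨pa, ?_⟩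
      rintro ⟨β, hβ, δ, hδ, e⟩
      obtain ⟨r, hr, rfl⟩ := (hpos β).mp hβ
      obtain ⟨t, ht, rfl⟩ := (hpos δ).mp hδ
      rw [← vec_add] at e
      exact (posL_sum r hr t ht).1 (g.vec_inj (e.symm.trans ea))
    · refine ⟨pb, ?_⟩
      rintro ⟨β, hβ, δ, hδ, e⟩
      obtain ⟨r, hr, rfl⟩ := (hpos β).mp hβ
      obtain ⟨t, ht, rfl⟩ := (hpos δ).mp hδ
      rw [← vec_add] at e
      exact (posL_sum r hr t ht).2 (g.vec_inj (e.symm.trans eb))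

/-- letter to simple root -/
def letter (a b : V) (i : Bool) : V := if i then b else a

theorem act_step (i : Bool) (M : (ℤ × ℤ) × (ℤ × ℤ)) (p : ℤ × ℤ) :
    act (step i M) p = act (gen i) (act M p) := by
  simp only [act, step]
  ext <;> simp only <;> ring

namespace PB

variable {D : RootSystemData V} {a b : V}

theorem prod_vec (h : PB D a b) (l : List Bool) (p : ℤ × ℤ) :
    wordProd (l.map (letter a b)) (vec a b p) = vec a b (act (evalW l) p) := by
  induction l with
  | nil => simp [wordProd, evalW, act]
  | cons i l ih =>
    have e : wordProd ((i :: l).map (letter a b)) =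
        reflEnd (letter a b i) * wordProd (l.map (letter a b)) := by simp [wordProd]
    rw [e, Module.End.mul_apply, ih, show evalW (i :: l) = step i (evalW l) from rfl, act_step]
    cases i
    · exact h.toGP.refl_a _
    · exact h.toGP.refl_b _

theorem end_ext (h : PB D a b) {f g : Module.End ℝ V}
    (hfg : ∀ p, f (vec a b p) = g (vec a b p)) : f = g := by
  refine LinearMap.ext_on D.span_eq_top ?_
  intro γ hγ
  obtain ⟨p, -, rfl⟩ := (h.roots_iff γ).mp hγ
  exact hfg p

theorem prod_eq_iff (h : PB D a b) (l l' : List Bool) :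
    wordProd (l.map (letter a b)) = wordProd (l'.map (letter a b)) ↔ evalW l = evalW l' := by
  constructor
  · intro e
    have e1 := congrArg (fun f => f (vec a b (1, 0))) e
    have e2 := congrArg (fun f => f (vec a b (0, 1))) e
    simp only [h.prod_vec] at e1 e2
    have e1 := h.toGP.vec_inj e1
    have e2 := h.toGP.vec_inj e2
    simp [act] at e1 e2
    ext <;> tauto
  · intro e
    exact h.end_ext fun p => by rw [h.prod_vec, h.prod_vec, e]

theorem isWord_map (h : PB D a b) (l : List Bool) : D.IsWord (l.map (letter a b)) := by
  intro γ hγ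
  obtain ⟨i, -, rfl⟩ := List.mem_map.mp hγ
  rw [h.simple_iff]
  cases i <;> simp [letter]

theorem word_lift (h : PB D a b) : ∀ l : List V, D.IsWord l →
    ∃ l' : List Bool, l = l'.map (letter a b) := by
  intro l
  induction l with
  | nil => exact fun _ => ⟨[], rfl⟩
  | cons x l ih =>
    intro hl
    obtain ⟨l', rfl⟩ := ih fun y hy => hl y (List.mem_cons_of_mem _ hy)
    rcases (h.simple_iff x).mp (hl x List.mem_cons_self) with rfl | rfl
    · exact ⟨false :: l', by simp [letter]⟩
    · exact ⟨true :: l', by simp [letter]⟩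

/-- every Weyl group element is given by one of the twelve words -/
theorem exists_word (h : PB D a b) {w : Module.End ℝ V} (hw : D.InWeyl w) :
    ∃ u ∈ redWords, w = wordProd (u.map (letter a b)) := by
  obtain ⟨l, hl, rfl⟩ := hw
  obtain ⟨l', rfl⟩ := h.word_lift l hl
  obtain ⟨u, hu, e, -⟩ := exists_red l'
  exact ⟨u, hu, ((h.prod_eq_iff _ _).mpr e).symm⟩

theorem red_isReduced (h : PB D a b) {u : List Bool} (hu : u ∈ redWords) :
    D.IsReducedWord (u.map (letter a b)) := by
  refine ⟨h.isWord_map u, fun l hl e => ?_⟩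
  obtain ⟨l', rfl⟩ := h.word_lift l hl
  simpa using red_min hu ((h.prod_eq_iff _ _).mp e)

theorem len_eq (h : PB D a b) {u : List Bool} (hu : u ∈ redWords) :
    D.len (wordProd (u.map (letter a b))) = u.length := by
  apply le_antisymm
  · exact Nat.sInf_le ⟨_, h.isWord_map u, rfl, by simp⟩
  · refine le_csInf ⟨_, _, h.isWord_map u, rfl, rfl⟩ ?_
    rintro n ⟨l, hl, e, rfl⟩
    simpa using (h.red_isReduced hu).2 l hl e

theorem mem_pos_vec (h : PB D a b) (p : ℤ × ℤ) : vec a b p ∈ D.pos ↔ p ∈ posL := by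
  rw [h.pos_iff']
  refine ⟨?_, fun hp => ⟨p, hp, rfl⟩⟩
  rintro ⟨r, hr, e⟩
  rwa [h.toGP.vec_inj e]

theorem mem_inv (h : PB D a b) {u : List Bool} (hu : u ∈ redWords) (γ : V) :
    γ ∈ D.inversions (wordProd (u.map (letter a b))) ↔
      ∃ p ∈ posL, act (evalW u) p ∉ posL ∧ γ = vec a b p := by
  constructor
  · rintro ⟨h1, -, h3⟩
    obtain ⟨p, hp, rfl⟩ := (h.pos_iff' γ).mp h1
    rw [h.prod_vec, h.mem_pos_vec] at h3
    exact ⟨p, hp, h3, rfl⟩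
  · rintro ⟨p, hp, hn, rfl⟩
    refine ⟨(h.mem_pos_vec p).mpr hp, ?_, ?_⟩
    · rw [h.prod_vec]; exact h.toGP.vec_mem (redWords_root u hu p hp)
    · rwa [h.prod_vec, h.mem_pos_vec]

theorem cpair_nonneg (h : PB D a b) (p : ℤ × ℤ) {r : ℤ × ℤ} (hr : r ∈ posL) :
    0 ≤ cpair (vec a b p) (vec a b r) ↔ 0 ≤ bf p r := by
  have hpos : 0 < ⟪vec a b r, vec a b r⟫ :=
    real_inner_self_pos.mpr (D.ne_zero _ (h.toGP.vec_mem (posL_rootL r hr)))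
  rw [cpair, h.toGP.inner_vec, le_div_iff₀ hpos, zero_mul, mul_nonneg_iff_of_pos_right h.toGP.apos]
  exact_mod_cast Iff.rfl

/-- the order of the Coxeter element is six -/
theorem order (h : PB D a b) (i : Bool) :
    orderOf (reflEnd (letter a b i) * reflEnd (letter a b (!i))) = 6 := by
  have pw : ∀ n : ℕ, (reflEnd (letter a b i) * reflEnd (letter a b (!i))) ^ n =
      wordProd ((List.replicate n [i, !i]).flatten.map (letter a b)) := by
    intro n
    induction n with
    | zero => simp [wordProd]
    | succ n ih =>
      rw [pow_succ', ih, List.replicate_succ]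
      simp [wordProd, mul_assoc]
  have one : (1 : Module.End ℝ V) = wordProd (([] : List Bool).map (letter a b)) := by
    simp [wordProd]
  rw [orderOf_eq_iff (by norm_num)]
  constructor
  · rw [pw, one, h.prod_eq_iff]
    cases i <;> decide
  · intro m hm h0
    rw [pw, one, Ne, h.prod_eq_iff]
    interval_cases m <;> cases i <;> decide

theorem not_commute (h : PB D a b) : ¬ Commute (reflEnd a) (reflEnd b) := by
  intro hc
  have : wordProd ([false, true].map (letter a b)) = wordProd ([true, false].map (letter a b)) := by
    simpa [wordProd, letter] using hc.eq
  rw [h.prod_eq_iff] at this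
  exact absurd this (by decide)

end PB

theorem altWord_length (n : ℕ) : ∀ α β : V, (altWord α β n).length = n := by
  induction n with
  | zero => intro α β; rfl
  | succ n ih => intro α β; simp [altWord, ih]

/-- Let `W` be the Weyl group of the root system of type `G₂`.
Then (a) `w ∈ W` is fully commutative iff `ℓ(w) ≤ 5`, and (b) `w` satisfies
`⟨α, β⟩ ≥ 0` for all `α, β ∈ Φ(w)` iff `ℓ(w) ≤ 4`. (In particular, in type `G₂`
full commutativity is not equivalent to nonnegativity of the pairings on the
inversion set.) -/
theorem g2_fullyCommutative_length
    {V : Type*} [NormedAddCommGroup V] [InnerProductSpace ℝ V]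
    (D : RootSystemData V) (hG2 : D.IsG2)
    (w : Module.End ℝ V) (hw : D.InWeyl w) :
    (D.FullyCommutative w ↔ D.len w ≤ 5) ∧
      ((∀ α ∈ D.inversions w, ∀ β ∈ D.inversions w, 0 ≤ cpair α β) ↔
        D.len w ≤ 4) := by
  obtain ⟨a, b, h⟩ := exists_PB D hG2
  obtain ⟨u, hu, rfl⟩ := h.exists_word hw
  rw [h.len_eq hu]
  refine ⟨⟨fun hf => ?_, fun hl => ⟨hw, ?_⟩⟩, ?_⟩
  · rcases redWords_six u hu with h5 | rfl
    · exact h5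
    · exfalso
      refine hf.2 _ (h.red_isReduced hu) rfl a ((h.simple_iff a).mpr (Or.inl rfl)) b
        ((h.simple_iff b).mpr (Or.inr rfl)) h.not_commute ?_
      have := h.order false
      simp only [letter, Bool.not_false, if_true, Bool.false_eq_true, if_false] at this
      rw [this]
      simp [altWord, letter]
  · intro l hl e α hα β hβ hc hi
    have hlen : l.length ≤ u.length := by
      simpa using hl.2 _ (h.isWord_map u) e.symm
    have ho : orderOf (reflEnd α * reflEnd β) = 6 := by
      rcases (h.simple_iff α).mp hα with rfl | rfl <;> rcases (h.simple_iff β).mp hβ with rfl | rfl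
      · exact absurd (Commute.refl _) hc
      · simpa [letter] using h.order false
      · simpa [letter] using h.order true
      · exact absurd (Commute.refl _) hc
    have := hi.length_le
    rw [altWord_length, ho] at this
    omega
  · rw [← redWords_pair u hu]
    constructor
    · intro H p hp r hr hp' hr'
      exact (h.cpair_nonneg p hr).mp (H _ ((h.mem_inv hu _).mpr ⟨p, hp, hp', rfl⟩) _
        ((h.mem_inv hu _).mpr ⟨r, hr, hr', rfl⟩))
    · intro H α hα β hβ
      obtain ⟨p, hp, hp', rfl⟩ := (h.mem_inv hu _).mp hα
      obtain ⟨r, hr, hr', rfl⟩ := (h.mem_inv hu _).mp hβ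
      exact (h.cpair_nonneg p hr).mpr (H p hp r hr hp' hr')
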